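/- arXiv:2402.15669 — 2 statements merged into one kernel-verified Lean document; each statement's English description precedes it below -/
import Mathlib

section
/- Let n ≥ 3 and k ≥ 2 be integers with n > k. Then per L(B(n,k)) = (2n − 2k + 1)·per Q_{k−1} + per Q_{k−2}, where Q_j denotes the j×j matrix obtained from the Laplacian matrix L(P_{j+1}) of the path on j+1 vertices by deleting the row and column indexed by one endvertex of the path (with per Q_0 = 1). -/
open scoped Classical

/-- Permanent of the principal submatrix of the Laplacian of `G` obtained by deleting the
rows and columns indexed by vertices in `S`. -/
noncomputable def permDel {V : Type*} [Fintype V] (G : SimpleGraph V) (S : Set V) : ℝ :=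
  ((G.lapMatrix ℝ).submatrix (fun i : ↥(Sᶜ) => (i : V)) (fun i : ↥(Sᶜ) => (i : V))).permanent

/-- `per Q_k`: the permanent of the `k × k` matrix obtained from the Laplacian of the path
on `k+1` vertices by deleting the row and column indexed by the endvertex `0`. -/
noncomputable def permQ (k : ℕ) : ℝ :=
  permDel (SimpleGraph.pathGraph (k + 1)) ({0} : Set (Fin (k + 1)))

/-- Permanent of the Laplacian matrix of `G` (over `ℝ`). -/
noncomputable def permL {V : Type*} [Fintype V] (G : SimpleGraph V) : ℝ :=
  (G.lapMatrix ℝ).permanent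

/-- The broom graph `B(n,k)`: a path on vertices `0, …, k-1` with `n-k` pendant edges
attached at the endvertex `k-1`. -/
def broom (n k : ℕ) : SimpleGraph (Fin n) :=
  SimpleGraph.fromRel fun i j =>
    ((j : ℕ) = (i : ℕ) + 1 ∧ (j : ℕ) < k) ∨ ((i : ℕ) = k - 1 ∧ k ≤ (j : ℕ))

namespace Matrix

variable {α β R : Type*} [CommRing R]

theorem permanent_submatrix_equiv [DecidableEq α] [Fintype α] [DecidableEq β] [Fintype β]
    (e : α ≃ β) (M : Matrix β β R) : (M.submatrix e e).permanent = M.permanent := by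
  unfold permanent
  rw [← Equiv.sum_comp e.permCongr]
  refine Finset.sum_congr rfl fun σ _ => ?_
  rw [← Equiv.prod_comp e]
  simp [Equiv.permCongr_apply]

/-- Expansion of the permanent along a column with a single nonzero entry, on the diagonal. -/
theorem permanent_option_of_col_eq_zero [DecidableEq α] [Fintype α]
    (M : Matrix (Option α) (Option α) R) (h : ∀ i, M (some i) none = 0) :
    M.permanent = M none none * (M.submatrix some some).permanent := by
  unfold permanent
  rw [← Equiv.sum_comp Equiv.Perm.decomposeOption.symm, Fintype.sum_prod_type,
    Fintype.sum_option, Finset.mul_sum]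
  simp [Fintype.prod_option, h]

theorem permanent_updateCol_single [DecidableEq α] [Fintype α] (M : Matrix α α R) (p : α) :
    (M.updateCol p (Pi.single p 1)).permanent =
      ∑ τ : Equiv.Perm α, if τ p = p then ∏ x ∈ Finset.univ.erase p, M (τ x) x else 0 := by
  unfold permanent
  refine Finset.sum_congr rfl fun τ _ => ?_
  rw [← Finset.mul_prod_erase _ _ (Finset.mem_univ p), updateCol_self, Pi.single_apply]
  split_ifs with h
  · rw [one_mul]
    refine Finset.prod_congr rfl fun x hx => ?_
    rw [updateCol_ne (Finset.ne_of_mem_erase hx)]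
  · rw [zero_mul]

/-- Expansion of the permanent at an index joined to a single other index `p`. -/
theorem permanent_option_of_pendant [DecidableEq α] [Fintype α]
    (M : Matrix (Option α) (Option α) R) (p : α)
    (hcol : ∀ i, i ≠ p → M (some i) none = 0) (hrow : ∀ i, i ≠ p → M none (some i) = 0) :
    M.permanent = M none none * (M.submatrix some some).permanent +
      M (some p) none * M none (some p) *
        ((M.submatrix some some).updateCol p (Pi.single p 1)).permanent := by
  rw [permanent_updateCol_single]
  unfold permanent
  rw [← Equiv.sum_comp Equiv.Perm.decomposeOption.symm, Fintype.sum_prod_type,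
    Fintype.sum_option, Finset.mul_sum, Finset.mul_sum]
  congr 1
  · simp [Fintype.prod_option]
  rw [Finset.sum_eq_single p]
  · refine Finset.sum_congr rfl fun τ _ => ?_
    rw [Fintype.prod_option]
    by_cases h : τ p = p
    · rw [if_pos h, ← Finset.mul_prod_erase _ _ (Finset.mem_univ p), ← mul_assoc]
      congr 1
      · simp [h]
      · refine Finset.prod_congr rfl fun x hx => ?_
        have hx : τ x ≠ p := fun h' => Finset.ne_of_mem_erase hx (τ.injective (h'.trans h.symm))
        simp [Equiv.swap_apply_of_ne_of_ne, hx]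
    · have hne : τ.symm p ≠ p := fun h' => h (by rw [← h', τ.apply_symm_apply, h'])
      rw [if_neg h, mul_zero]
      apply mul_eq_zero_of_right
      apply Finset.prod_eq_zero (Finset.mem_univ (τ.symm p))
      simp [hrow _ hne]
  · intro q _ hq
    refine Finset.sum_eq_zero fun τ _ => ?_
    simp [Fintype.prod_option, hcol q hq]
  · simp

theorem permanent_add_single [DecidableEq α] [Fintype α] (M : Matrix α α R) (p : α) :
    (M + single p p 1).permanent =
      M.permanent + (M.updateCol p (Pi.single p 1)).permanent := by
  rw [permanent_updateCol_single]
  unfold permanent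
  rw [← Finset.sum_add_distrib]
  refine Finset.sum_congr rfl fun τ _ => ?_
  rw [← Finset.mul_prod_erase _ _ (Finset.mem_univ p),
    ← Finset.mul_prod_erase Finset.univ (fun x => M (τ x) x) (Finset.mem_univ p)]
  have key : ∏ x ∈ Finset.univ.erase p, (M + single p p 1 : Matrix α α R) (τ x) x =
      ∏ x ∈ Finset.univ.erase p, M (τ x) x := by
    refine Finset.prod_congr rfl fun x hx => ?_
    simp [(Finset.ne_of_mem_erase hx).symm]
  rw [key]
  by_cases h : τ p = p
  · simp [h, add_mul]
  · simp [h, Ne.symm h]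

/-- The permanent of the leading `n × n` block of an infinite matrix. -/
def leadingPermanent (n : ℕ) (f : ℕ → ℕ → R) : R :=
  (of fun i j : Fin n => f i j).permanent

theorem leadingPermanent_congr {n : ℕ} {f g : ℕ → ℕ → R}
    (h : ∀ i < n, ∀ j < n, f i j = g i j) : leadingPermanent n f = leadingPermanent n g := by
  unfold leadingPermanent
  congr 1
  ext i j
  exact h i i.2 j j.2

theorem leadingPermanent_succ_eq (n : ℕ) (f : ℕ → ℕ → R) :
    leadingPermanent (n + 1) f =
      ((of fun i j : Fin (n + 1) => f i j).submatrix finSuccEquivLast.symm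
        finSuccEquivLast.symm).permanent :=
  (permanent_submatrix_equiv _ _).symm

theorem leadingPermanent_succ_of_col_eq_zero {n : ℕ} {f : ℕ → ℕ → R}
    (h : ∀ i < n, f i n = 0) :
    leadingPermanent (n + 1) f = f n n * leadingPermanent n f := by
  rw [leadingPermanent_succ_eq, permanent_option_of_col_eq_zero]
  · simp only [submatrix_apply, of_apply, finSuccEquivLast_symm_none, Fin.val_last]
    congr 2
    ext i j
    simp
  · intro i
    simpa using h i i.2

/-- Replace column `p` of `f` by the `p`-th unit vector. -/
def unitCol (f : ℕ → ℕ → R) (p : ℕ) (i j : ℕ) : R :=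
  if j = p then (if i = p then 1 else 0) else f i j

theorem updateCol_of_eq_unitCol {n : ℕ} (f : ℕ → ℕ → R) (p : Fin n) :
    (of fun i j : Fin n => f i j).updateCol p (Pi.single p 1) =
      of fun i j : Fin n => unitCol f p i j := by
  ext i j
  simp [updateCol_apply, unitCol, Pi.single_apply, Fin.ext_iff]

theorem leadingPermanent_succ_of_pendant {n p : ℕ} {f : ℕ → ℕ → R} (hp : p < n)
    (hcol : ∀ i < n, i ≠ p → f i n = 0) (hrow : ∀ i < n, i ≠ p → f n i = 0) :
    leadingPermanent (n + 1) f = f n n * leadingPermanent n f +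
      f p n * f n p * leadingPermanent n (unitCol f p) := by
  have hsub : ((of fun i j : Fin (n + 1) => f i j).submatrix finSuccEquivLast.symm
      finSuccEquivLast.symm).submatrix some some = of fun i j : Fin n => f i j := by
    ext i j
    simp
  rw [leadingPermanent_succ_eq, permanent_option_of_pendant _ ⟨p, hp⟩, hsub,
    updateCol_of_eq_unitCol]
  · simp [leadingPermanent]
  · intro i hi
    simpa using hcol i i.2 (fun h => hi (Fin.ext h))
  · intro i hi
    simpa using hrow i i.2 (fun h => hi (Fin.ext h))

theorem leadingPermanent_add_unitCol {n p : ℕ} {f g : ℕ → ℕ → R} (hp : p < n)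
    (hg : ∀ i < n, ∀ j < n, g i j = f i j + if i = p ∧ j = p then 1 else 0) :
    leadingPermanent n g = leadingPermanent n f + leadingPermanent n (unitCol f p) := by
  have hmat : (of fun i j : Fin n => g i j) =
      (of fun i j : Fin n => f i j) + single ⟨p, hp⟩ ⟨p, hp⟩ 1 := by
    ext i j
    simp [hg i i.2 j j.2, single_apply, Fin.ext_iff, eq_comm]
  unfold leadingPermanent
  rw [hmat, permanent_add_single, updateCol_of_eq_unitCol]

end Matrix

open Matrix

/-- The Laplacian matrix of the one-way infinite path with endvertex `0`. -/
def pathEntry (i j : ℕ) : ℝ :=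
  if i = j then (if i = 0 then 1 else 2) else if i + 1 = j ∨ j + 1 = i then -1 else 0

/-- The Laplacian matrix of a broom with arbitrarily many pendant edges at `k - 1`, with the
diagonal entry at `k - 1` replaced by `d`. -/
def broomEntry (k : ℕ) (d : ℝ) (i j : ℕ) : ℝ :=
  if i = j then (if i + 1 = k then d else if i = 0 ∨ k ≤ i then 1 else 2)
  else if (i + 1 = j ∧ j < k) ∨ (j + 1 = i ∧ i < k) ∨ (i + 1 = k ∧ k ≤ j) ∨ (j + 1 = k ∧ k ≤ i)
    then -1 else 0

theorem leadingPermanent_broomEntry_add (k m : ℕ) (hk : 0 < k) (d : ℝ) :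
    leadingPermanent (k + m) (broomEntry k d) = leadingPermanent k (broomEntry k (d + m)) := by
  induction m generalizing d with
  | zero => simp
  | succ m ih =>
    have h1 : leadingPermanent (k + m) (broomEntry k (d + 1)) =
        leadingPermanent (k + m) (broomEntry k d) +
          leadingPermanent (k + m) (unitCol (broomEntry k d) (k - 1)) := by
      refine leadingPermanent_add_unitCol (by omega) fun i _ j _ => ?_
      unfold broomEntry
      split_ifs <;> first | omega | simp
    have hdiag : broomEntry k d (k + m) (k + m) = 1 := by
      unfold broomEntry
      split_ifs <;> first | omega | rfl
    have hcol : broomEntry k d (k - 1) (k + m) = -1 := by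
      unfold broomEntry
      split_ifs <;> first | omega | rfl
    have hrow : broomEntry k d (k + m) (k - 1) = -1 := by
      unfold broomEntry
      split_ifs <;> first | omega | rfl
    rw [← add_assoc, leadingPermanent_succ_of_pendant (p := k - 1) (by omega), hdiag, hcol, hrow]
    · rw [one_mul, neg_mul_neg, one_mul, one_mul, ← h1, ih]
      push_cast
      ring_nf
    · intro i _ _
      unfold broomEntry
      split_ifs <;> first | omega | rfl
    · intro i _ _
      unfold broomEntry
      split_ifs <;> first | omega | rfl

theorem leadingPermanent_broomEntry_self (j : ℕ) (d : ℝ) :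
    leadingPermanent (j + 2) (broomEntry (j + 2) d) =
      d * leadingPermanent (j + 1) pathEntry + leadingPermanent j pathEntry := by
  have hdiag : broomEntry (j + 2) d (j + 1) (j + 1) = d := by simp [broomEntry]
  have hcol : broomEntry (j + 2) d j (j + 1) = -1 := by simp [broomEntry]
  have hrow : broomEntry (j + 2) d (j + 1) j = -1 := by simp [broomEntry]
  rw [leadingPermanent_succ_of_pendant (p := j) (by omega), hdiag, hcol, hrow,
    leadingPermanent_succ_of_col_eq_zero (f := unitCol _ j)]
  · rw [neg_mul_neg, one_mul, one_mul]
    congr 1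
    · congr 1
      refine leadingPermanent_congr fun i _ l _ => ?_
      unfold broomEntry pathEntry
      split_ifs <;> first | omega | rfl
    · have hunit : unitCol (broomEntry (j + 2) d) j j j = 1 := by simp [unitCol]
      rw [hunit, one_mul]
      refine leadingPermanent_congr fun i _ l _ => ?_
      unfold unitCol broomEntry pathEntry
      split_ifs <;> first | omega | rfl
  · intro i hi
    simp [unitCol, hi.ne]
  · intro i _ _
    unfold broomEntry
    split_ifs <;> first | omega | rfl
  · intro i _ _
    unfold broomEntry
    split_ifs <;> first | omega | rfl

theorem SimpleGraph.lapMatrix_apply_eq_ite {V : Type*} [Fintype V] [DecidableEq V]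
    (G : SimpleGraph V) [DecidableRel G.Adj] (i j : V) :
    G.lapMatrix ℝ i j = if i = j then (G.degree i : ℝ) else if G.Adj i j then -1 else 0 := by
  by_cases h : i = j
  · subst h
    simp [SimpleGraph.lapMatrix, SimpleGraph.degMatrix]
  · simp [SimpleGraph.lapMatrix, SimpleGraph.degMatrix, h, SimpleGraph.adjMatrix_apply]
    split_ifs <;> simp

theorem SimpleGraph.degree_eq_card_of_forall_adj_iff {V : Type*} [Fintype V]
    (G : SimpleGraph V) [DecidableRel G.Adj] (v : V) (s : Finset V)
    (h : ∀ w, G.Adj v w ↔ w ∈ s) : G.degree v = s.card := by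
  rw [← SimpleGraph.card_neighborFinset_eq_degree]
  congr 1
  ext w
  rw [SimpleGraph.mem_neighborFinset, h]

theorem broom_adj (n k : ℕ) (hk : 2 ≤ k) (i j : Fin n) :
    (broom n k).Adj i j ↔ ((i : ℕ) + 1 = j ∧ (j : ℕ) < k) ∨ ((j : ℕ) + 1 = i ∧ (i : ℕ) < k) ∨
      ((i : ℕ) + 1 = k ∧ k ≤ j) ∨ ((j : ℕ) + 1 = k ∧ k ≤ i) := by
  simp only [broom, SimpleGraph.fromRel_adj, ne_eq, Fin.ext_iff]
  omega

theorem lapMatrix_broom_apply (n k : ℕ) (hk : 2 ≤ k) (hnk : k < n)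
    [DecidableRel (broom n k).Adj] (i j : Fin n) :
    (broom n k).lapMatrix ℝ i j = broomEntry k ((n : ℝ) - k + 1) i j := by
  rw [SimpleGraph.lapMatrix_apply_eq_ite]
  unfold broomEntry
  simp only [Fin.ext_iff, broom_adj n k hk]
  by_cases hij : (i : ℕ) = j
  · rw [if_pos hij, if_pos hij]
    split_ifs with h1 h2
    · rw [SimpleGraph.degree_eq_card_of_forall_adj_iff _ _
        (insert ⟨k - 2, by omega⟩ (Finset.Ici ⟨k, hnk⟩)), Finset.card_insert_of_notMem,
        Fin.card_Ici]
      · push_cast [Nat.cast_sub hnk.le]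
        rfl
      · simp only [Finset.mem_Ici, Fin.le_def]
        omega
      · intro w
        simp only [broom_adj n k hk, Finset.mem_insert, Finset.mem_Ici, Fin.le_def, Fin.ext_iff]
        omega
    · rw [SimpleGraph.degree_eq_card_of_forall_adj_iff _ _
        {⟨if (i : ℕ) = 0 then 1 else k - 1, by split_ifs <;> omega⟩}, Finset.card_singleton,
        Nat.cast_one]
      intro w
      simp only [broom_adj n k hk, Finset.mem_singleton, Fin.ext_iff]
      split_ifs <;> omega
    · rw [SimpleGraph.degree_eq_card_of_forall_adj_iff _ _
        {⟨i - 1, by omega⟩, ⟨i + 1, by omega⟩}, Finset.card_pair, Nat.cast_ofNat]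
      · simp only [ne_eq, Fin.ext_iff]
        omega
      · intro w
        simp only [broom_adj n k hk, Finset.mem_insert, Finset.mem_singleton, Fin.ext_iff]
        omega
  · rw [if_neg hij, if_neg hij]

theorem lapMatrix_pathGraph_rev_succ (k : ℕ) [DecidableRel (SimpleGraph.pathGraph (k + 1)).Adj]
    (i j : Fin k) :
    (SimpleGraph.pathGraph (k + 1)).lapMatrix ℝ i.rev.succ j.rev.succ = pathEntry i j := by
  rw [SimpleGraph.lapMatrix_apply_eq_ite]
  unfold pathEntry
  have hi := i.2
  have hj := j.2
  by_cases hij : (i : ℕ) = j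
  · rw [if_pos hij, if_pos (by rw [Fin.ext hij])]
    split_ifs with h1
    · rw [SimpleGraph.degree_eq_card_of_forall_adj_iff _ _ {⟨k - 1, by omega⟩},
        Finset.card_singleton, Nat.cast_one]
      intro w
      simp only [SimpleGraph.pathGraph_adj, Finset.mem_singleton, Fin.ext_iff, Fin.val_succ,
        Fin.val_rev]
      omega
    · rw [SimpleGraph.degree_eq_card_of_forall_adj_iff _ _
        {⟨k - i - 1, by omega⟩, ⟨k - i + 1, by omega⟩}, Finset.card_pair, Nat.cast_ofNat]
      · simp only [ne_eq, Fin.ext_iff]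
        omega
      · intro w
        simp only [SimpleGraph.pathGraph_adj, Finset.mem_insert, Finset.mem_singleton,
          Fin.ext_iff, Fin.val_succ, Fin.val_rev]
        omega
  · rw [if_neg hij, if_neg (by simp [Fin.ext_iff]; omega)]
    refine if_congr ?_ rfl rfl
    simp only [SimpleGraph.pathGraph_adj, Fin.val_succ, Fin.val_rev]
    omega

theorem permQ_eq_leadingPermanent (k : ℕ) : permQ k = leadingPermanent k pathEntry := by
  let e : Fin k ≃ ↥(({0} : Set (Fin (k + 1)))ᶜ) :=
    Fin.revPerm.trans (finSuccAboveEquiv (0 : Fin (k + 1)))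
  have he : ∀ i, (e i : Fin (k + 1)) = i.rev.succ := fun i => rfl
  unfold permQ permDel leadingPermanent
  refine (@permanent_submatrix_equiv _ _ ℝ _ _ _ (_) (_) e _).symm.trans ?_
  congr 1
  ext i j
  simp only [submatrix_apply, of_apply, he]
  rw [← lapMatrix_pathGraph_rev_succ]
  congr!

/-- `per L(B(n,k)) = (2n − 2k + 1)·per Q_{k−1} + per Q_{k−2}`. -/
theorem permL_broom_eq (n k : ℕ) (hn : 3 ≤ n) (hk : 2 ≤ k) (hnk : k < n) :
    permL (broom n k)
      = (2 * (n : ℝ) - 2 * (k : ℝ) + 1) * permQ (k - 1) + permQ (k - 2) := by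
  have hL : permL (broom n k) = leadingPermanent n (broomEntry k ((n : ℝ) - k + 1)) := by
    unfold permL leadingPermanent
    congr!
    ext i j
    rw [of_apply, ← lapMatrix_broom_apply n k hk hnk]
    congr!
  obtain ⟨m, rfl⟩ := Nat.exists_eq_add_of_le hnk.le
  obtain ⟨j, rfl⟩ := Nat.exists_eq_add_of_le' hk
  rw [hL, leadingPermanent_broomEntry_add _ _ (by omega), leadingPermanent_broomEntry_self,
    permQ_eq_leadingPermanent, permQ_eq_leadingPermanent]
  simp only [Nat.add_sub_cancel, show j + 2 - 1 = j + 1 from rfl]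
  push_cast
  ring
end

section
/- Let T be a tree with at least 4 vertices and let v be a vertex of T of degree 2. Then 2·per L_v(T) ≤ per L(T) ≤ 4·per L_v(T). -/
open scoped Classical

/-- The summand of the permanent of the Laplacian of `G` that belongs to `σ`. -/
noncomputable def lapTerm {V : Type*} [Fintype V] (G : SimpleGraph V) (σ : Equiv.Perm V) : ℝ :=
  ∏ i, G.lapMatrix ℝ (σ i) i

section LaplacianPermanent

open Finset

variable {V : Type*} [Fintype V] {G : SimpleGraph V}

lemma lapMatrix_apply_self (G : SimpleGraph V) (i : V) : G.lapMatrix ℝ i i = G.degree i := by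
  simp [SimpleGraph.lapMatrix, SimpleGraph.degMatrix]

lemma lapMatrix_apply_adj {i j : V} (h : G.Adj i j) : G.lapMatrix ℝ i j = -1 := by
  simp [SimpleGraph.lapMatrix, SimpleGraph.degMatrix, h, h.ne]

lemma lapMatrix_apply_eq_zero {i j : V} (hne : i ≠ j) (h : ¬ G.Adj i j) :
    G.lapMatrix ℝ i j = 0 := by
  simp [SimpleGraph.lapMatrix, SimpleGraph.degMatrix, h, hne]

/-- The terms of the Laplacian permanent of a bipartite graph are nonnegative. -/
lemma lapTerm_nonneg (hG : G.IsBipartite) (σ : Equiv.Perm V) : 0 ≤ lapTerm G σ := by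
  obtain ⟨c⟩ := hG
  let ε : V → ℝ := fun i => if c i = 0 then 1 else -1
  have hε (i : V) : ε i * ε i = 1 := by
    simp only [ε]; split_ifs <;> norm_num
  have hone : ∏ i, ε (σ i) * ε i = 1 := by
    rw [prod_mul_distrib, Equiv.prod_comp σ ε, ← prod_mul_distrib]
    exact prod_eq_one fun i _ => hε i
  rw [← mul_one (lapTerm G σ), ← hone, lapTerm, ← prod_mul_distrib]
  refine prod_nonneg fun i _ => ?_
  by_cases hi : σ i = i
  · rw [hi, hε, lapMatrix_apply_self, mul_one]
    positivity
  by_cases hadj : G.Adj (σ i) i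
  · have hc : c (σ i) ≠ c i := c.valid hadj
    have hεε : ε (σ i) * ε i = -1 := by
      simp only [ε]
      split_ifs <;> first | omega | norm_num
    rw [lapMatrix_apply_adj hadj, hεε]
    norm_num
  · rw [lapMatrix_apply_eq_zero hi hadj, zero_mul]

lemma eq_or_adj_of_lapTerm_ne_zero {σ : Equiv.Perm V} (h : lapTerm G σ ≠ 0) (i : V) :
    σ i = i ∨ G.Adj (σ i) i := by
  by_contra! hi
  exact h (prod_eq_zero (mem_univ i) (lapMatrix_apply_eq_zero hi.1 hi.2))

/-- A permutation contributing to the Laplacian permanent that crosses a bridge crosses it back. -/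
lemma apply_eq_of_isBridge {σ : Equiv.Perm V} (h : lapTerm G σ ≠ 0) {v a : V}
    (hb : G.IsBridge s(v, a)) (hv : σ v = a) : σ a = v := by
  by_contra hne
  let H := G.deleteEdges {s(v, a)}
  let C : Finset V := {i | H.Reachable a i}
  have hvC : v ∉ C := by
    simp only [C, mem_filter, mem_univ, true_and]
    exact fun hr => (SimpleGraph.isBridge_iff.1 hb) hr.symm
  have hmaps : ∀ i ∈ C, σ i ∈ C := by
    intro i hi
    have hiv : i ≠ v := fun h' => hvC (h' ▸ hi)
    rcases eq_or_adj_of_lapTerm_ne_zero h i with hi' | hadj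
    · rwa [hi']
    simp only [C, mem_filter, mem_univ, true_and] at hi ⊢
    refine hi.trans (SimpleGraph.Adj.reachable ?_)
    rw [SimpleGraph.deleteEdges_adj]
    refine ⟨hadj.symm, ?_⟩
    simp only [Set.mem_singleton_iff, Sym2.eq_iff, not_or, not_and]
    refine ⟨fun h' => absurd h' hiv, ?_⟩
    rintro rfl
    exact hne
  obtain ⟨i, hi, hia⟩ := surjOn_of_injOn_of_card_le σ hmaps σ.injective.injOn le_rfl
    (show a ∈ (C : Set V) by simp [C])
  exact hvC (σ.injective (hia.trans hv.symm) ▸ hi)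

lemma permL_eq_sum_lapTerm (G : SimpleGraph V) : permL G = ∑ σ, lapTerm G σ := rfl

lemma permDel_singleton (G : SimpleGraph V) (v : V) :
    permDel G {v} =
      ∑ σ : Equiv.Perm V with σ v = v, ∏ i ∈ univ.erase v, G.lapMatrix ℝ (σ i) i := by
  rw [permDel, Matrix.permanent,
    sum_subtype (p := fun σ : Equiv.Perm V => ∀ i, ¬ i ∈ ({v}ᶜ : Set V) → σ i = i) _ (by simp)]
  refine Fintype.sum_equiv (Equiv.Perm.subtypeEquivSubtypePerm (· ∈ ({v}ᶜ : Set V))) _ _ ?_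
  intro σ
  rw [prod_subtype (p := (· ∈ ({v}ᶜ : Set V))) (univ.erase v) (by simp)]
  refine prod_congr rfl fun i _ => ?_
  rw [Equiv.Perm.subtypeEquivSubtypePerm_apply_of_mem _ i.2]
  rfl

lemma sum_lapTerm_fixed (G : SimpleGraph V) (v : V) :
    ∑ σ : Equiv.Perm V with σ v = v, lapTerm G σ = G.degree v * permDel G {v} := by
  rw [permDel_singleton, mul_sum]
  refine sum_congr rfl fun σ hσ => ?_
  rw [lapTerm, ← mul_prod_erase _ _ (mem_univ v), (mem_filter.1 hσ).2, lapMatrix_apply_self]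

/-- If `σ` exchanges the adjacent vertices `v` and `a`, then undoing this exchange multiplies
the term of `σ` by the product of the two degrees. -/
lemma lapTerm_swap_mul {σ : Equiv.Perm V} {v a : V} (hadj : G.Adj v a) (hv : σ v = a)
    (ha : σ a = v) :
    lapTerm G (Equiv.swap v a * σ) = G.degree v * (G.degree a * lapTerm G σ) := by
  have hmem : a ∈ univ.erase v := by simp [hadj.ne']
  have hrest : ∀ i ∈ (univ.erase v).erase a, (Equiv.swap v a * σ) i = σ i := by
    intro i hi
    simp only [mem_erase, mem_univ, and_true] at hi
    refine Equiv.swap_apply_of_ne_of_ne ?_ ?_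
    · exact fun h => hi.1 (σ.injective (h.trans ha.symm))
    · exact fun h => hi.2 (σ.injective (h.trans hv.symm))
  simp only [lapTerm]
  rw [← mul_prod_erase _ _ (mem_univ v), ← mul_prod_erase _ _ hmem,
    ← mul_prod_erase univ (fun i => G.lapMatrix ℝ (σ i) i) (mem_univ v),
    ← mul_prod_erase _ (fun i => G.lapMatrix ℝ (σ i) i) hmem,
    prod_congr rfl fun i hi => by rw [hrest i hi]]
  simp [hv, ha, lapMatrix_apply_self, lapMatrix_apply_adj hadj, lapMatrix_apply_adj hadj.symm]

lemma degree_mul_lapTerm_le (hG : G.IsAcyclic) {σ : Equiv.Perm V} {v a : V} (hadj : G.Adj v a)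
    (hv : σ v = a) : G.degree v * lapTerm G σ ≤ lapTerm G (Equiv.swap v a * σ) := by
  by_cases h : lapTerm G σ = 0
  · rw [h, mul_zero]
    exact lapTerm_nonneg hG.isBipartite _
  have hb := SimpleGraph.isAcyclic_iff_forall_adj_isBridge.1 hG hadj
  rw [lapTerm_swap_mul hadj hv (apply_eq_of_isBridge h hb hv)]
  have hdeg : (1 : ℝ) ≤ G.degree a := by
    exact_mod_cast (G.degree_pos_iff_exists_adj a).2 ⟨v, hadj.symm⟩
  have := lapTerm_nonneg hG.isBipartite σ
  gcongr
  nlinarith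

lemma sum_lapTerm_adj_le (hG : G.IsAcyclic) {v a : V} (hadj : G.Adj v a) :
    ∑ σ : Equiv.Perm V with σ v = a, lapTerm G σ ≤ permDel G {v} := by
  have hdeg : (0 : ℝ) < G.degree v := by
    exact_mod_cast (G.degree_pos_iff_exists_adj v).2 ⟨a, hadj⟩
  refine le_of_mul_le_mul_left ?_ hdeg
  rw [← sum_lapTerm_fixed, mul_sum]
  refine (sum_le_sum fun σ hσ => degree_mul_lapTerm_le hG hadj (mem_filter.1 hσ).2).trans_eq ?_
  refine sum_equiv (Equiv.mulLeft (Equiv.swap v a)) (fun σ => ?_) fun σ _ => rfl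
  simp [Equiv.swap_apply_eq_iff]

lemma degree_mul_permDel_le_permL (hG : G.IsBipartite) (v : V) :
    G.degree v * permDel G {v} ≤ permL G := by
  rw [← sum_lapTerm_fixed, permL_eq_sum_lapTerm]
  exact sum_le_sum_of_subset_of_nonneg (subset_univ _) fun σ _ _ => lapTerm_nonneg hG σ

lemma permL_le_two_mul_degree_mul_permDel (hG : G.IsAcyclic) (v : V) :
    permL G ≤ 2 * G.degree v * permDel G {v} := by
  have hzero : ∀ a ∈ univ.erase v, a ∉ G.neighborFinset v →
      ∑ σ : Equiv.Perm V with σ v = a, lapTerm G σ = 0 := by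
    intro a ha hna
    refine sum_eq_zero fun σ hσ => by_contra fun h => ?_
    rcases eq_or_adj_of_lapTerm_ne_zero h v with h' | h' <;> rw [(mem_filter.1 hσ).2] at h'
    · exact (mem_erase.1 ha).1 h'
    · exact hna ((G.mem_neighborFinset v a).2 h'.symm)
  have hsub : G.neighborFinset v ⊆ univ.erase v := fun a ha => by
    simpa using ((G.mem_neighborFinset v a).1 ha).ne'
  have hle : ∑ a ∈ G.neighborFinset v, ∑ σ : Equiv.Perm V with σ v = a, lapTerm G σ ≤
      G.degree v * permDel G {v} := by
    rw [← nsmul_eq_mul, ← G.card_neighborFinset_eq_degree]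
    exact sum_le_card_nsmul _ _ _ fun a ha =>
      sum_lapTerm_adj_le hG ((G.mem_neighborFinset v a).1 ha)
  rw [permL_eq_sum_lapTerm, ← sum_fiberwise univ (fun σ : Equiv.Perm V => σ v),
    ← add_sum_erase _ _ (mem_univ v), sum_lapTerm_fixed, ← sum_subset hsub hzero]
  linarith

end LaplacianPermanent

/-- for a tree `T` with at least 4 vertices and a vertex `v` of degree 2,
`2·per L_v(T) ≤ per L(T) ≤ 4·per L_v(T)`. -/
theorem permL_between_of_degree_two {V : Type*} [Fintype V] (T : SimpleGraph V)
    (hT : T.IsTree) (hcard : 4 ≤ Fintype.card V) (v : V) (hv : T.degree v = 2) :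
    2 * permDel T {v} ≤ permL T ∧ permL T ≤ 4 * permDel T {v} := by
  have hlower := degree_mul_permDel_le_permL hT.isBipartite v
  have hupper := permL_le_two_mul_degree_mul_permDel hT.isAcyclic v
  rw [hv] at hlower hupper
  norm_num at hlower hupper
  exact ⟨hlower, hupper⟩
end
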